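/- Let q ≥ 1 and a be integers with gcd(a, q) = 1, let x ≥ 2 be a real number with q ≤ x, and let 0 < Y ≤ x. Let b : ℕ → ℂ be supported on prime powers and satisfy |b(n)| ≤ log n for all n. Then | Σ_{x<n≤x+Y} b(n) e(na/q) − (1/φ(q)) Σ_{χ mod q} τ(χ̄) χ(a) Σ_{x<n≤x+Y} b(n) χ(n) | ≤ 2 ω(q) (log 2x)², where the sum over χ runs over all Dirichlet characters modulo q. -/

import Mathlib

/-- `e(x) = e^{2πix}`. -/
noncomputable def e (x : ℝ) : ℂ := Complex.exp (2 * Real.pi * Complex.I * (x : ℂ))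

/-- The Gauss sum `τ(ψ) = ∑_{b mod q} ψ(b) e(b/q)` of a Dirichlet character mod `q`. -/
noncomputable def tau {q : ℕ} [NeZero q] (ψ : DirichletCharacter ℂ q) : ℂ :=
  ∑ b : ZMod q, ψ b * e ((b.val : ℝ) / (q : ℝ))

/-- The conjugate character `χ̄` of a Dirichlet character `χ`. -/
noncomputable def conjChar {q : ℕ} (χ : DirichletCharacter ℂ q) : DirichletCharacter ℂ q :=
  χ.ringHomComp (starRingEnd ℂ)

theorem e_intCast_div (q : ℕ) [NeZero q] (m : ℤ) :
    e ((m : ℝ) / (q : ℝ)) = ZMod.stdAddChar (m : ZMod q) := by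
  rw [ZMod.stdAddChar_coe, e]
  push_cast
  ring_nf

theorem norm_e (t : ℝ) : ‖e t‖ = 1 := by
  rw [e, show 2 * (Real.pi : ℂ) * Complex.I * (t : ℂ) = ((2 * Real.pi * t : ℝ) : ℂ) * Complex.I by
    push_cast; ring]
  exact Complex.norm_exp_ofReal_mul_I _

/-- Orthogonality of characters, in the form that expands an additive character. -/
theorem sum_tau_conjChar_mul {q : ℕ} [NeZero q] (m : ZMod q) :
    ∑ χ : DirichletCharacter ℂ q, tau (conjChar χ) * χ m
      = if IsUnit m then (q.totient : ℂ) * ZMod.stdAddChar m else 0 := by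
  have orth (c : ZMod q) : ∑ χ : DirichletCharacter ℂ q, conjChar χ c * χ m
      = if IsUnit m ∧ c = m then (q.totient : ℂ) else 0 := by
    by_cases hc : IsUnit c
    · have h := DirichletCharacter.sum_char_inv_mul_char_eq ℂ hc m
      have hconj (χ : DirichletCharacter ℂ q) : conjChar χ c = χ c⁻¹ := by
        obtain ⟨u, rfl⟩ := hc
        have h1 : χ (u : ZMod q)⁻¹ * χ u = 1 := by
          rw [← map_mul, ZMod.inv_mul_of_unit _ u.isUnit, map_one]
        have h2 : conjChar χ u * χ u = 1 := by
          change (starRingEnd ℂ) (χ u) * χ u = 1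
          rw [mul_comm, Complex.mul_conj, Complex.normSq_eq_norm_sq,
            DirichletCharacter.unit_norm_eq_one]
          simp
        exact mul_right_cancel₀ (right_ne_zero_of_mul_eq_one h1) (h2.trans h1.symm)
      simp_rw [hconj, h]
      by_cases hcm : c = m
      · subst hcm; simp [hc]
      · simp [hcm]
    · rw [if_neg (by rintro ⟨h, rfl⟩; exact hc h)]
      refine Finset.sum_eq_zero fun χ _ => ?_
      rw [(conjChar χ).map_nonunit hc, zero_mul]
  have hval (c : ZMod q) : e ((c.val : ℝ) / (q : ℝ)) = ZMod.stdAddChar c := by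
    simpa using e_intCast_div q (c.val : ℤ)
  calc ∑ χ : DirichletCharacter ℂ q, tau (conjChar χ) * χ m
      = ∑ c : ZMod q, ZMod.stdAddChar c *
          ∑ χ : DirichletCharacter ℂ q, conjChar χ c * χ m := by
        simp_rw [tau, hval, Finset.sum_mul, Finset.mul_sum]
        rw [Finset.sum_comm]
        refine Finset.sum_congr rfl fun c _ => Finset.sum_congr rfl fun χ _ => ?_
        ring
    _ = _ := by
        simp_rw [orth]
        by_cases hm : IsUnit m <;> simp [hm, mul_comm]

/-- An interval `(x, 2x]` contains at most one power of each prime, so it contains at most `ω(q)`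
prime powers that are not coprime to `q`. -/
theorem card_isPrimePow_not_coprime_le {q : ℕ} (hq : q ≠ 0) {x : ℝ} {S : Finset ℕ}
    (hS : ∀ n ∈ S, x < n ∧ (n : ℝ) ≤ 2 * x ∧ IsPrimePow n ∧ ¬ n.Coprime q) :
    S.card ≤ q.primeFactors.card := by
  refine Finset.card_le_card_of_injOn Nat.minFac (fun n hn => ?_) fun n hn m hm hnm => ?_
  · obtain ⟨-, -, hpp, hcop⟩ := hS n hn
    obtain ⟨p, k, hp, hk, rfl⟩ := (isPrimePow_nat_iff n).1 hpp
    rw [hp.pow_minFac hk.ne']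
    rw [Nat.coprime_pow_left_iff hk, hp.coprime_iff_not_dvd, not_not] at hcop
    exact Nat.mem_primeFactors.2 ⟨hp, hcop, hq⟩
  · obtain ⟨hn1, hn2, hnp, -⟩ := hS n hn
    obtain ⟨hm1, hm2, hmp, -⟩ := hS m hm
    obtain ⟨p, k, hp, hk, rfl⟩ := (isPrimePow_nat_iff n).1 hnp
    obtain ⟨r, l, hr, hl, rfl⟩ := (isPrimePow_nat_iff m).1 hmp
    rw [hp.pow_minFac hk.ne', hr.pow_minFac hl.ne'] at hnm
    subst hnm
    have key {i j : ℕ} (hi : x < (p ^ i : ℕ)) (hj : ((p ^ j : ℕ) : ℝ) ≤ 2 * x) : j ≤ i := by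
      by_contra! hij
      have h : 2 * p ^ i ≤ p ^ j :=
        calc 2 * p ^ i ≤ p * p ^ i := Nat.mul_le_mul_right _ hp.two_le
          _ = p ^ (i + 1) := (pow_succ' p i).symm
          _ ≤ p ^ j := Nat.pow_le_pow_right hp.pos hij
      have h' : (2 : ℝ) * (p ^ i : ℕ) ≤ (p ^ j : ℕ) := by exact_mod_cast h
      linarith
    rw [le_antisymm (key hm1 hn2) (key hn1 hm2)]

/-- Conversion from additive to multiplicative characters (from the proof of
Proposition 3.1): for integers `q ≥ 1` and `a` with `gcd(a,q) = 1`, a real `x ≥ 2`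
with `q ≤ x`, a real `0 < Y ≤ x`, and `b : ℕ → ℂ` supported on prime powers with
`|b(n)| ≤ log n`, one has
`|∑_{x<n≤x+Y} b(n) e(na/q)
   - (1/φ(q)) ∑_{χ mod q} τ(χ̄) χ(a) ∑_{x<n≤x+Y} b(n) χ(n)| ≤ 2 ω(q) (log 2x)²`. -/
theorem stmt_6 (q : ℕ) [NeZero q] (a : ℤ) (ha : Int.gcd a (q : ℤ) = 1)
    (x : ℝ) (hx : 2 ≤ x) (hqx : (q : ℝ) ≤ x) (Y : ℝ) (hY : 0 < Y) (hYx : Y ≤ x)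
    (b : ℕ → ℂ) (hb : ∀ n, b n ≠ 0 → IsPrimePow n)
    (hb' : ∀ n : ℕ, ‖b n‖ ≤ Real.log n) :
    ‖(∑' n : ℕ, if x < (n : ℝ) ∧ (n : ℝ) ≤ x + Y
          then b n * e ((n : ℝ) * (a : ℝ) / (q : ℝ)) else 0)
      - (1 / (q.totient : ℂ)) *
          ∑ χ : DirichletCharacter ℂ q, tau (conjChar χ) * χ ((a : ℤ) : ZMod q) *
            ∑' n : ℕ, if x < (n : ℝ) ∧ (n : ℝ) ≤ x + Y
              then b n * χ ((n : ℕ) : ZMod q) else 0‖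
      ≤ 2 * (q.primeFactors.card : ℝ) * (Real.log (2 * x)) ^ 2 := by
  set S : Finset ℕ := Finset.Ioc ⌊x⌋₊ ⌊x + Y⌋₊ with hSdef
  have hmem (n : ℕ) : n ∈ S ↔ x < (n : ℝ) ∧ (n : ℝ) ≤ x + Y := by
    rw [hSdef, Finset.mem_Ioc, Nat.floor_lt (by linarith), Nat.le_floor_iff (by linarith)]
  have hts (f : ℕ → ℂ) :
      (∑' n : ℕ, if x < (n : ℝ) ∧ (n : ℝ) ≤ x + Y then f n else 0) = ∑ n ∈ S, f n := by
    simp_rw [← hmem]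
    rw [tsum_eq_sum (s := S) fun n hn => if_neg hn]
    exact Finset.sum_congr rfl fun n hn => if_pos hn
  have hφ : (q.totient : ℂ) ≠ 0 := by
    exact_mod_cast (Nat.totient_pos.2 (NeZero.pos q)).ne'
  have ha' : IsUnit ((a : ℤ) : ZMod q) :=
    (ZMod.coe_int_isUnit_iff_isCoprime a q).2 (Int.isCoprime_iff_gcd_eq_one.2 ha).symm
  have hchar : (1 / (q.totient : ℂ)) *
      ∑ χ : DirichletCharacter ℂ q, tau (conjChar χ) * χ ((a : ℤ) : ZMod q) *
        ∑ n ∈ S, b n * χ ((n : ℕ) : ZMod q)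
      = ∑ n ∈ S, if n.Coprime q then b n * e ((n : ℝ) * (a : ℝ) / (q : ℝ)) else 0 := by
    simp_rw [Finset.mul_sum]
    rw [Finset.sum_comm]
    refine Finset.sum_congr rfl fun n _ => ?_
    have h := sum_tau_conjChar_mul (q := q) ((a : ZMod q) * (n : ZMod q))
    have hu : IsUnit ((a : ZMod q) * (n : ZMod q)) ↔ n.Coprime q := by
      rw [IsUnit.mul_iff, ZMod.isUnit_iff_coprime]
      exact and_iff_right ha'
    have he : e ((n : ℝ) * (a : ℝ) / (q : ℝ))
        = ZMod.stdAddChar ((a : ZMod q) * (n : ZMod q)) := by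
      have := e_intCast_div q ((n : ℤ) * a)
      push_cast at this
      rw [this, mul_comm]
    calc _ = (1 / (q.totient : ℂ)) * b n * ∑ χ : DirichletCharacter ℂ q,
          tau (conjChar χ) * χ ((a : ZMod q) * (n : ZMod q)) := by
          rw [Finset.mul_sum]
          refine Finset.sum_congr rfl fun χ _ => ?_
          rw [map_mul]
          ring
      _ = _ := by
          rw [h, he]
          simp_rw [hu]
          split_ifs
          · field_simp
          · simp
  simp_rw [hts]
  rw [hchar, ← Finset.sum_sub_distrib]
  set T := S.filter fun n => IsPrimePow n ∧ ¬ n.Coprime q with hT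
  have hL : 1 ≤ Real.log (2 * x) := by
    rw [Real.le_log_iff_exp_le (by linarith)]
    linarith [Real.exp_one_lt_d9]
  have hcard : (T.card : ℝ) ≤ q.primeFactors.card := by
    refine Nat.cast_le.2 (card_isPrimePow_not_coprime_le (x := x) (NeZero.ne q) fun n hn => ?_)
    obtain ⟨h1, h2⟩ := Finset.mem_filter.1 hn
    obtain ⟨h3, h4⟩ := (hmem n).1 h1
    exact ⟨h3, by linarith, h2⟩
  have hsum : ∑ n ∈ T, b n * e ((n : ℝ) * (a : ℝ) / (q : ℝ))
      = ∑ n ∈ S, (b n * e ((n : ℝ) * (a : ℝ) / (q : ℝ))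
        - if n.Coprime q then b n * e ((n : ℝ) * (a : ℝ) / (q : ℝ)) else 0) := by
    rw [hT, Finset.sum_filter]
    refine Finset.sum_congr rfl fun n _ => ?_
    by_cases hc : n.Coprime q
    · rw [if_neg fun h => h.2 hc, if_pos hc, sub_self]
    · by_cases hbn : b n = 0
      · simp [hbn]
      · simp [hc, hb n hbn]
  rw [← hsum]
  calc _ ≤ T.card • Real.log (2 * x) := by
        rw [← Finset.sum_const]
        refine norm_sum_le_of_le T fun n hn => ?_
        obtain ⟨h3, h4⟩ := (hmem n).1 (Finset.mem_filter.1 hn).1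
        rw [norm_mul, norm_e, mul_one]
        exact (hb' n).trans (Real.log_le_log (by linarith) (by linarith))
    _ ≤ q.primeFactors.card * Real.log (2 * x) := by
        rw [nsmul_eq_mul]
        gcongr
    _ ≤ _ := by
        have h0 : (0 : ℝ) ≤ q.primeFactors.card := Nat.cast_nonneg _
        have h1 : Real.log (2 * x) ≤ 2 * Real.log (2 * x) ^ 2 := by nlinarith
        calc _ ≤ (q.primeFactors.card : ℝ) * (2 * Real.log (2 * x) ^ 2) := by gcongr
          _ = _ := by ring
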